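/- For a vector x = (x_1,…,x_K) of positive reals, define h_k(x) = (1/N)·Σ_{j=1}^{N_k} δ_{kj}/(1 + ḡ_k δ_{kj}), where ḡ_k is the unique solution with 0 ≤ ḡ_k and x_k ḡ_k < c_k c̄_k of ḡ_k = (1/N)·tr( P_k ( x_k P_k + (c̄_k − x_k ḡ_k) I_{n_k} )^{-1} ), and (δ_{kj}) is the unique nonnegative solution of the δ-system with parameters (ḡ_1,…,ḡ_K). Then h is scalable: for every real α > 1, every vector x of positive reals and every k ∈ {1,…,K}, α · h_k(x_1,…,x_K) > h_k(α x_1,…,α x_K). -/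

import Mathlib

open Matrix
open scoped ComplexOrder

/-- The δ-system: `δ_{kj} = (1/N)·tr(R_{kj} ((1/N)·Σ_{l,m} ḡ_l R_{lm}/(1+ḡ_l δ_{lm}) + ρ I_N)⁻¹)`. -/
def DeltaSystem (N K : ℕ) (Nk : Fin K → ℕ)
    (R : (k : Fin K) → Fin (Nk k) → Matrix (Fin N) (Fin N) ℂ) (ρ : ℝ)
    (gbar : Fin K → ℝ) (δ : (k : Fin K) → Fin (Nk k) → ℝ) : Prop :=
  ∀ k j, ((δ k j : ℂ)) = (1 / (N : ℂ)) *
    (R k j *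
      ((1 / (N : ℂ)) • (∑ l, ∑ m, ((gbar l / (1 + gbar l * δ l m) : ℝ) : ℂ) • R l m)
        + (ρ : ℂ) • (1 : Matrix (Fin N) (Fin N) ℂ))⁻¹).trace

/-- The characterization of `ḡ_k` as the unique solution with `0 ≤ ḡ_k`,
`x_k ḡ_k < c_k c̄_k` of `ḡ_k = (1/N)·tr(P_k (x_k P_k + (c̄_k − x_k ḡ_k) I)⁻¹)`. -/
def GbarSystem (N K : ℕ) (nk : Fin K → ℕ) (c cbar : Fin K → ℝ)
    (P : (k : Fin K) → Matrix (Fin (nk k)) (Fin (nk k)) ℝ)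
    (x gbar : Fin K → ℝ) : Prop :=
  ∀ k, 0 ≤ gbar k ∧ x k * gbar k < c k * cbar k ∧
    gbar k = (1 / (N : ℝ)) *
      (P k * (x k • P k +
        (cbar k - x k * gbar k) • (1 : Matrix (Fin (nk k)) (Fin (nk k)) ℝ))⁻¹).trace

open scoped MatrixOrder in
/-- The trace of the product of a nonzero positive semidefinite matrix and a positive definite
matrix is positive. -/
theorem Matrix.PosSemidef.trace_mul_pos {n : Type*} [Fintype n] [DecidableEq n]
    {T M : Matrix n n ℂ} (hT : T.PosSemidef) (hT0 : T ≠ 0) (hM : M.PosDef) :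
    0 < (T * M).trace := by
  obtain ⟨U, hU⟩ := CStarAlgebra.nonneg_iff_eq_star_mul_self.mp hM.posSemidef.nonneg
  rw [star_eq_conjTranspose] at hU
  have hUunit : IsUnit U := by
    have h := (isUnit_iff_isUnit_det _).mp hM.isUnit
    rw [hU, det_mul] at h
    exact (isUnit_iff_isUnit_det _).mpr (isUnit_of_mul_isUnit_right h)
  have htr : (T * M).trace = (U * T * Uᴴ).trace := by
    rw [hU, ← mul_assoc, trace_mul_comm, ← mul_assoc]
  have hpsd : (U * T * Uᴴ).PosSemidef := hT.mul_mul_conjTranspose_same U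
  rw [htr]
  refine lt_of_le_of_ne hpsd.trace_nonneg fun h0 => hT0 ?_
  have h := hpsd.trace_eq_zero_iff.mp h0.symm
  rw [mul_assoc] at h
  have h2 : T * Uᴴ = 0 := hUunit.mul_left_cancel (by rw [h, mul_zero])
  have hUs : IsUnit Uᴴ := hUunit.star
  exact hUs.mul_right_cancel (by rw [h2, zero_mul])

/-- Inversion is strictly antitone on positive definite matrices. -/
theorem Matrix.PosDef.inv_sub_inv {n : Type*} [Fintype n] [DecidableEq n]
    {A B : Matrix n n ℂ} (hA : A.PosDef) (hB : B.PosDef) (hBA : (B - A).PosDef) :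
    (A⁻¹ - B⁻¹).PosDef := by
  have hAd := (isUnit_iff_isUnit_det _).mp hA.isUnit
  have hBd := (isUnit_iff_isUnit_det _).mp hB.isUnit
  have hBi : (B⁻¹)ᴴ = B⁻¹ := hB.inv.isHermitian
  have hCi : (B - A)ᴴ = B - A := hBA.isHermitian
  have h1 : (B⁻¹ * (B - A) * (B⁻¹)ᴴ).PosDef :=
    hBA.mul_mul_conjTranspose_same (vecMul_injective_iff_isUnit.mpr hB.inv.isUnit)
  have h2 : (B⁻¹ * (B - A) * A⁻¹ * (B⁻¹ * (B - A))ᴴ).PosSemidef :=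
    hA.inv.posSemidef.mul_mul_conjTranspose_same _
  convert h1.add_posSemidef h2 using 1
  rw [conjTranspose_mul, hBi, hCi]
  have e1 : B⁻¹ * (B - A) = 1 - B⁻¹ * A := by rw [mul_sub, nonsing_inv_mul _ hBd]
  have e2 : (B - A) * B⁻¹ = 1 - A * B⁻¹ := by rw [sub_mul, mul_nonsing_inv _ hBd]
  have e3 : (1 - B⁻¹ * A) * A⁻¹ = A⁻¹ - B⁻¹ := by
    rw [sub_mul, one_mul, mul_assoc, mul_nonsing_inv _ hAd, mul_one]
  rw [e1, e2, e3, sub_mul, one_mul, mul_sub, mul_one, sub_mul, ← mul_assoc A⁻¹,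
    nonsing_inv_mul _ hAd, one_mul, mul_assoc]
  abel

/-- If `A < q B` for positive definite matrices, then `tr (T B⁻¹) < q tr (T A⁻¹)` for nonzero
positive semidefinite `T`. -/
theorem Matrix.PosSemidef.trace_mul_inv_lt {n : Type*} [Fintype n] [DecidableEq n]
    {T A B : Matrix n n ℂ} (hT : T.PosSemidef) (hT0 : T ≠ 0) (hA : A.PosDef) (hB : B.PosDef)
    {q : ℝ} (hq : 0 < q) (hBA : ((q : ℂ) • B - A).PosDef) :
    (T * B⁻¹).trace < (q : ℂ) * (T * A⁻¹).trace := by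
  have hq' : (0 : ℂ) < q := by exact_mod_cast hq
  have hBd := (isUnit_iff_isUnit_det _).mp hB.isUnit
  have hinv : ((q : ℂ) • B)⁻¹ = (q : ℂ)⁻¹ • B⁻¹ := by
    refine inv_eq_right_inv ?_
    rw [smul_mul_smul_comm, mul_nonsing_inv _ hBd, mul_inv_cancel₀ hq'.ne', one_smul]
  have h := hT.trace_mul_pos hT0 (hA.inv_sub_inv (hB.smul hq') hBA)
  have h2 := mul_pos hq' h
  rw [hinv, mul_sub, trace_sub, mul_smul_comm, trace_smul, mul_sub, smul_eq_mul,
    mul_inv_cancel_left₀ hq'.ne'] at h2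
  exact sub_pos.mp h2

/-- A nonnegative combination of positive semidefinite matrices plus a positive multiple of the
identity is positive definite. -/
theorem posDef_smul_sum_add_smul_one {n : Type*} [Fintype n] [DecidableEq n]
    {K : Type*} [Fintype K] {J : K → Type*} [∀ k, Fintype (J k)]
    {R : (k : K) → J k → Matrix n n ℂ} (hR : ∀ k j, (R k j).PosSemidef)
    {a : (k : K) → J k → ℝ} (ha : ∀ k j, 0 ≤ a k j) {t : ℂ} (ht : 0 ≤ t) {ρ : ℝ} (hρ : 0 < ρ) :
    (t • (∑ l, ∑ m, (a l m : ℂ) • R l m) + (ρ : ℂ) • (1 : Matrix n n ℂ)).PosDef := by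
  refine PosDef.posSemidef_add ?_ (PosDef.one.smul (by exact_mod_cast hρ))
  refine PosSemidef.smul ?_ ht
  exact posSemidef_sum _ fun l _ => posSemidef_sum _ fun m _ =>
    (hR l m).smul (by exact_mod_cast ha l m)

/-- The solution of the δ-system is positive. -/
theorem DeltaSystem.pos {N K : ℕ} {Nk : Fin K → ℕ}
    {R : (k : Fin K) → Fin (Nk k) → Matrix (Fin N) (Fin N) ℂ} {ρ : ℝ} {g : Fin K → ℝ}
    {δ : (k : Fin K) → Fin (Nk k) → ℝ} (hN : 0 < N)
    (hR : ∀ k j, (R k j).PosSemidef) (hR0 : ∀ k j, R k j ≠ 0) (hρ : 0 < ρ)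
    (hg : ∀ k, 0 ≤ g k) (hδ0 : ∀ k j, 0 ≤ δ k j) (hδ : DeltaSystem N K Nk R ρ g δ)
    (k : Fin K) (j : Fin (Nk k)) : 0 < δ k j := by
  have hN' : (0 : ℂ) < 1 / (N : ℂ) := one_div_pos.mpr (by exact_mod_cast hN)
  have ha : ∀ l m, 0 ≤ g l / (1 + g l * δ l m) := fun l m =>
    div_nonneg (hg l) (add_nonneg zero_le_one (mul_nonneg (hg l) (hδ0 l m)))
  have h := mul_pos hN' ((hR k j).trace_mul_pos (hR0 k j)
    (posDef_smul_sum_add_smul_one hR ha hN'.le hρ).inv)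
  rw [← hδ k j] at h
  exact_mod_cast h

/-- Strict scalability of the right-hand side of the δ-system at a pair of solutions. -/
theorem DeltaSystem.lt_mul_of_le_mul {N K : ℕ} {Nk : Fin K → ℕ}
    {R : (k : Fin K) → Fin (Nk k) → Matrix (Fin N) (Fin N) ℂ} {ρ q : ℝ} {g g' : Fin K → ℝ}
    {δ δ' : (k : Fin K) → Fin (Nk k) → ℝ} (hN : 0 < N)
    (hR : ∀ k j, (R k j).PosSemidef) (hR0 : ∀ k j, R k j ≠ 0) (hρ : 0 < ρ)
    (hg : ∀ k, 0 ≤ g k) (hg' : ∀ k, 0 ≤ g' k)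
    (hδ0 : ∀ k j, 0 ≤ δ k j) (hδ : DeltaSystem N K Nk R ρ g δ)
    (hδ0' : ∀ k j, 0 ≤ δ' k j) (hδ' : DeltaSystem N K Nk R ρ g' δ')
    (hq : 1 < q) (hgg : ∀ k, g k ≤ q * g' k) (hle : ∀ k j, δ' k j ≤ q * δ k j)
    (k : Fin K) (j : Fin (Nk k)) : δ' k j < q * δ k j := by
  have hN' : (0 : ℂ) < 1 / (N : ℂ) := one_div_pos.mpr (by exact_mod_cast hN)
  have hd : ∀ l m, 0 < 1 + g l * δ l m := fun l m =>
    add_pos_of_pos_of_nonneg one_pos (mul_nonneg (hg l) (hδ0 l m))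
  have hd' : ∀ l m, 0 < 1 + g' l * δ' l m := fun l m =>
    add_pos_of_pos_of_nonneg one_pos (mul_nonneg (hg' l) (hδ0' l m))
  have ha : ∀ l m, 0 ≤ g l / (1 + g l * δ l m) := fun l m => div_nonneg (hg l) (hd l m).le
  have hb : ∀ l m, 0 ≤ g' l / (1 + g' l * δ' l m) := fun l m => div_nonneg (hg' l) (hd' l m).le
  have hab : ∀ l m,
      0 ≤ q * (g' l / (1 + g' l * δ' l m)) - g l / (1 + g l * δ l m) := fun l m => by
    rw [sub_nonneg, ← mul_div_assoc, div_le_div_iff₀ (hd l m) (hd' l m)]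
    nlinarith [hgg l, mul_le_mul_of_nonneg_left (hle l m) (mul_nonneg (hg l) (hg' l))]
  have hdiff := posDef_smul_sum_add_smul_one hR hab hN'.le
    (mul_pos (sub_pos.mpr hq) hρ)
  have h := (hR k j).trace_mul_inv_lt (hR0 k j)
    (posDef_smul_sum_add_smul_one hR ha hN'.le hρ)
    (posDef_smul_sum_add_smul_one hR hb hN'.le hρ) (zero_lt_one.trans hq) (by
      convert hdiff using 1
      simp only [Complex.ofReal_sub, Complex.ofReal_mul, sub_smul, mul_smul,
        Finset.sum_sub_distrib, ← Finset.smul_sum, smul_add, smul_sub, sub_mul, one_mul]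
      rw [smul_comm (q : ℂ) (1 / (N : ℂ))]
      abel)
  have h2 := mul_lt_mul_of_pos_left h hN'
  rw [← hδ' k j, mul_left_comm, ← hδ k j] at h2
  exact_mod_cast h2

/-- Scaling `x` up by `α` shrinks `ḡ` by at most the factor `α`. -/
theorem le_mul_of_fixedPoint {n : ℕ} (hn : 0 < n) {N : ℝ} (hN : 0 < N) {p : Fin n → ℝ}
    (hp : ∀ i, 0 ≤ p i) {b x α g g' : ℝ} (hb : n / N ≤ b) (hx : 0 < x) (hα : 1 < α)
    (hg : x * g < b) (hg' : α * x * g' < b)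
    (h : g = 1 / N * ∑ i, p i / (x * p i + (b - x * g)))
    (h' : g' = 1 / N * ∑ i, p i / (α * x * p i + (b - α * x * g'))) : g ≤ α * g' := by
  have : Nonempty (Fin n) := ⟨⟨0, hn⟩⟩
  have key : ∀ {y u : ℝ}, 0 < y → y * u < b →
      u = 1 / N * ∑ i, p i / (y * p i + (b - y * u)) →
      n / N - y * u = (b - y * u) * (1 / N * ∑ i, 1 / (y * p i + (b - y * u))) := by
    intro y u hy hyu hu
    have hcount : (n : ℝ) = ∑ i : Fin n,
        (y * (p i / (y * p i + (b - y * u))) +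
          (b - y * u) * (1 / (y * p i + (b - y * u)))) := by
      have h1 : ∀ i : Fin n, y * (p i / (y * p i + (b - y * u))) +
          (b - y * u) * (1 / (y * p i + (b - y * u))) = 1 := fun i => by
        have : y * p i + (b - y * u) ≠ 0 :=
          (add_pos_of_nonneg_of_pos (mul_nonneg hy.le (hp i)) (sub_pos.mpr hyu)).ne'
        field_simp
      rw [Finset.sum_congr rfl fun i _ => h1 i]
      simp
    rw [Finset.sum_add_distrib, ← Finset.mul_sum, ← Finset.mul_sum] at hcount
    have hS : y * u = y * (1 / N * ∑ i, p i / (y * p i + (b - y * u))) := congrArg (y * ·) hu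
    linear_combination hcount / N - hS
  by_contra! hlt
  have hu : α * x * g' < x * g := by nlinarith
  have k1 := key hx hg h
  have k2 := key (mul_pos (zero_lt_one.trans hα) hx) hg' h'
  have hS : 1 / N * ∑ i, 1 / (α * x * p i + (b - α * x * g')) <
      1 / N * ∑ i, 1 / (x * p i + (b - x * g)) := by
    refine mul_lt_mul_of_pos_left (Finset.sum_lt_sum_of_nonempty Finset.univ_nonempty
      fun i _ => one_div_lt_one_div_of_lt ?_ ?_) (one_div_pos.mpr hN)
    · exact add_pos_of_nonneg_of_pos (mul_nonneg hx.le (hp i)) (sub_pos.mpr hg)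
    · nlinarith [mul_nonneg (mul_nonneg (sub_pos.mpr hα).le hx.le) (hp i)]
  have h3 := mul_lt_mul_of_pos_left hS (mul_pos (sub_pos.mpr hg) (sub_pos.mpr hg'))
  nlinarith [mul_nonneg (sub_nonneg.mpr hb) (sub_pos.mpr hu).le]

/-- The trace in the fixed-point equation of `ḡ`, for a diagonal matrix. -/
theorem Matrix.IsDiag.trace_mul_inv_smul_add_smul_one {n : ℕ} {P : Matrix (Fin n) (Fin n) ℝ}
    (hP : P.IsDiag) (hP0 : ∀ i, 0 ≤ P i i) {x v : ℝ} (hx : 0 < x) (hv : 0 < v) :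
    (P * (x • P + v • (1 : Matrix (Fin n) (Fin n) ℝ))⁻¹).trace =
      ∑ i, P i i / (x * P i i + v) := by
  have hinv : (x • P + v • (1 : Matrix (Fin n) (Fin n) ℝ))⁻¹ =
      diagonal fun i => (x * P i i + v)⁻¹ := by
    refine inv_eq_right_inv ?_
    have hd : x • P + v • (1 : Matrix (Fin n) (Fin n) ℝ) =
        diagonal fun i => x * P i i + v := by
      nth_rewrite 1 [← hP.diagonal_diag]
      rw [← diagonal_one, ← diagonal_smul, ← diagonal_smul, diagonal_add]
      simp
    rw [hd, diagonal_mul_diagonal, ← diagonal_one]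
    congr 1
    ext i
    exact mul_inv_cancel₀ (add_pos_of_nonneg_of_pos (mul_nonneg hx.le (hP0 i)) hv).ne'
  rw [hinv]
  simp [trace, mul_diagonal, div_eq_mul_inv]

/-- **Scalability of the interference functions `h_k`.** For every `α > 1` and every
positive vector `x`, `α · h_k(x) > h_k(α x)` for all `k`, where
`h_k(x) = (1/N)·Σ_j δ_{kj}/(1 + ḡ_k δ_{kj})`. -/
theorem h_scalable
    (N K : ℕ) (hN : 0 < N) (hK : 0 < K)
    (Nk nk : Fin K → ℕ) (hNk : ∀ k, 0 < Nk k) (hnk : ∀ k, 0 < nk k)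
    (hnkNk : ∀ k, nk k ≤ Nk k)
    (c cbar : Fin K → ℝ)
    (hc : ∀ k, c k = (nk k : ℝ) / (Nk k : ℝ))
    (hcbar : ∀ k, cbar k = (Nk k : ℝ) / (N : ℝ))
    (P : (k : Fin K) → Matrix (Fin (nk k)) (Fin (nk k)) ℝ)
    (hPdiag : ∀ k, (P k).IsDiag) (hPpos : ∀ k i, 0 ≤ P k i i) (hPne : ∀ k, P k ≠ 0)
    (R : (k : Fin K) → Fin (Nk k) → Matrix (Fin N) (Fin N) ℂ)
    (hRherm : ∀ k j, (R k j).IsHermitian) (hRpsd : ∀ k j, (R k j).PosSemidef)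
    (hRne : ∀ k j, R k j ≠ 0)
    (ρ : ℝ) (hρ : 0 < ρ)
    (α : ℝ) (hα : 1 < α)
    (x : Fin K → ℝ) (hx : ∀ k, 0 < x k)
    (gbar gbarα : Fin K → ℝ)
    (hgbar : GbarSystem N K nk c cbar P x gbar)
    (hgbarα : GbarSystem N K nk c cbar P (fun k => α * x k) gbarα)
    (δ δα : (k : Fin K) → Fin (Nk k) → ℝ)
    (hδ0 : ∀ k j, 0 ≤ δ k j) (hδ : DeltaSystem N K Nk R ρ gbar δ)
    (hδα0 : ∀ k j, 0 ≤ δα k j) (hδα : DeltaSystem N K Nk R ρ gbarα δα) :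
    ∀ k, α * ((1 / (N : ℝ)) * ∑ j, δ k j / (1 + gbar k * δ k j)) >
      (1 / (N : ℝ)) * ∑ j, δα k j / (1 + gbarα k * δα k j) := by
  have hNr : (0 : ℝ) < N := by exact_mod_cast hN
  have hα0 : 0 < α := zero_lt_one.trans hα
  have hg : ∀ k, 0 ≤ gbar k := fun k => (hgbar k).1
  have hgα : ∀ k, 0 ≤ gbarα k := fun k => (hgbarα k).1
  have hccbar : ∀ k, c k * cbar k = nk k / N := fun k => by
    have : (Nk k : ℝ) ≠ 0 := by exact_mod_cast (hNk k).ne'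
    rw [hc, hcbar]
    field_simp
  have hb : ∀ k, (nk k : ℝ) / N ≤ cbar k := fun k => by
    rw [hcbar]
    gcongr
    exact hnkNk k
  have hgg : ∀ k, gbar k ≤ α * gbarα k := fun k => by
    obtain ⟨-, h1, h2⟩ := hgbar k
    obtain ⟨-, h1', h2'⟩ := hgbarα k
    have hlt := h1.trans_le ((hccbar k).le.trans (hb k))
    have hlt' := h1'.trans_le ((hccbar k).le.trans (hb k))
    rw [(hPdiag k).trace_mul_inv_smul_add_smul_one (hPpos k) (hx k) (sub_pos.mpr hlt)] at h2
    rw [(hPdiag k).trace_mul_inv_smul_add_smul_one (hPpos k) (mul_pos hα0 (hx k))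
      (sub_pos.mpr hlt')] at h2'
    exact le_mul_of_fixedPoint (hnk k) hNr (hPpos k) (hb k) (hx k) hα hlt hlt' h2 h2'
  have hδpos := hδ.pos hN hRpsd hRne hρ hg hδ0
  have hδαpos := hδα.pos hN hRpsd hRne hρ hgα hδα0
  have hδlt : ∀ k j, δα k j < α * δ k j := by
    by_contra! hcon
    obtain ⟨k₀, j₀, h₀⟩ := hcon
    obtain ⟨⟨k, j⟩, -, hmax⟩ := Finset.exists_max_image
      (Finset.univ : Finset (Σ k, Fin (Nk k))) (fun i => δα i.1 i.2 / δ i.1 i.2)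
      ⟨⟨k₀, j₀⟩, Finset.mem_univ _⟩
    have hq : α ≤ δα k j / δ k j :=
      ((le_div_iff₀ (hδpos k₀ j₀)).mpr h₀).trans (hmax ⟨k₀, j₀⟩ (Finset.mem_univ _))
    have h := DeltaSystem.lt_mul_of_le_mul hN hRpsd hRne hρ hg hgα hδ0 hδ hδα0 hδα
      (hα.trans_le hq)
      (fun l => (hgg l).trans (mul_le_mul_of_nonneg_right hq (hgα l)))
      (fun l m => (div_le_iff₀ (hδpos l m)).mp (hmax ⟨l, m⟩ (Finset.mem_univ _))) k j
    rw [div_mul_cancel₀ _ (hδpos k j).ne'] at h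
    exact h.false
  intro k
  have : Nonempty (Fin (Nk k)) := ⟨⟨0, hNk k⟩⟩
  rw [gt_iff_lt, mul_left_comm, Finset.mul_sum _ _ α]
  refine mul_lt_mul_of_pos_left ?_ (one_div_pos.mpr hNr)
  refine Finset.sum_lt_sum_of_nonempty Finset.univ_nonempty fun j _ => ?_
  have hd := add_pos_of_pos_of_nonneg one_pos (mul_nonneg (hg k) (hδ0 k j))
  have hd' := add_pos_of_pos_of_nonneg one_pos (mul_nonneg (hgα k) (hδα0 k j))
  rw [← mul_div_assoc, div_lt_div_iff₀ hd' hd]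
  nlinarith [hδlt k j, mul_le_mul_of_nonneg_right (hgg k) (mul_nonneg (hδ0 k j) (hδα0 k j))]
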